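/- arXiv:2112.06738 — 2 statements merged into one kernel-verified Lean document; each statement's English description precedes it below -/
import Mathlib

section
/- Let α ∈ ℝ^N be nonzero, let l, r be nonnegative integers, and let p ∈ ℂ[x_1,…,x_N] satisfy: (α,x) divides p(x + sα) − p(x − sα) for s = 1,…,l, and (α,x) divides p(x + (l+2s)α) − p(x − (l+2s)α) for s = 1,…,r. Then the highest-degree homogeneous part p_0 of p satisfies: (α,x) divides ∂_α^{2s−1} p_0 for s = 1,…,l+r, where ∂_α is the directional derivative along α. -/
open MvPolynomial

noncomputable section

/-- The linear polynomial with coefficient vector `a`. -/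
def linPoly {n : ℕ} (a : Fin n → ℂ) : MvPolynomial (Fin n) ℂ :=
  ∑ i, MvPolynomial.C (a i) * MvPolynomial.X i

/-- Substitution `x ↦ x + v` on polynomials. -/
def shiftPoly {n : ℕ} (v : Fin n → ℂ) (p : MvPolynomial (Fin n) ℂ) :
    MvPolynomial (Fin n) ℂ :=
  MvPolynomial.aeval (fun i => MvPolynomial.X i + MvPolynomial.C (v i)) p

/-- The directional derivative `∂_a` along a vector `a`. -/
def dirDeriv {n : ℕ} (a : Fin n → ℂ) (p : MvPolynomial (Fin n) ℂ) :
    MvPolynomial (Fin n) ℂ :=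
  ∑ i, MvPolynomial.C (a i) * MvPolynomial.pderiv i p

/-- `dirDeriv a` as a derivation. -/
def dirDerivation {n : ℕ} (a : Fin n → ℂ) :
    Derivation ℂ (MvPolynomial (Fin n) ℂ) (MvPolynomial (Fin n) ℂ) :=
  ∑ i, (MvPolynomial.C (a i) : MvPolynomial (Fin n) ℂ) •
    (MvPolynomial.pderiv i : Derivation ℂ (MvPolynomial (Fin n) ℂ) (MvPolynomial (Fin n) ℂ))

theorem coe_dirDerivation {n : ℕ} (a : Fin n → ℂ) : ⇑(dirDerivation a) = dirDeriv a := by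
  funext p
  change Derivation.coeFnAddMonoidHom (dirDerivation a) p = _
  rw [dirDerivation, map_sum, Finset.sum_apply]
  rfl

theorem dirDeriv_X {n : ℕ} (a : Fin n → ℂ) (i : Fin n) :
    dirDeriv a (MvPolynomial.X i) = MvPolynomial.C (a i) := by
  classical
  simp [dirDeriv, MvPolynomial.pderiv_X, Pi.single_apply]

theorem coe_dirDerivation_pow {n : ℕ} (a : Fin n → ℂ) (k : ℕ) :
    ⇑((dirDerivation a).toLinearMap ^ k) = (dirDeriv a)^[k] := by
  rw [Module.End.coe_pow, ← coe_dirDerivation]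
  rfl

/-- The substitution `x ↦ x + t a`, as a polynomial in `t`. -/
def lineExpansion {n : ℕ} (a : Fin n → ℂ) :
    MvPolynomial (Fin n) ℂ →ₐ[ℂ] Polynomial (MvPolynomial (Fin n) ℂ) :=
  MvPolynomial.aeval fun i =>
    Polynomial.C (MvPolynomial.X i) + Polynomial.C (MvPolynomial.C (a i)) * Polynomial.X

theorem derivative_lineExpansion {n : ℕ} (a : Fin n → ℂ) (p : MvPolynomial (Fin n) ℂ) :
    Polynomial.derivative (lineExpansion a p) = lineExpansion a (dirDeriv a p) := by
  rw [← coe_dirDerivation]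
  induction p using MvPolynomial.induction_on with
  | C c =>
    simp [lineExpansion, MvPolynomial.algebraMap_eq, Polynomial.algebraMap_apply]
  | add p q hp hq => simp [hp, hq]
  | mul_X p i hp =>
    have hX : Polynomial.derivative (lineExpansion a (MvPolynomial.X i)) =
        lineExpansion a (dirDerivation a (MvPolynomial.X i)) := by
      rw [coe_dirDerivation, dirDeriv_X]
      simp [lineExpansion, MvPolynomial.algebraMap_eq, Polynomial.algebraMap_apply]
    rw [map_mul, Polynomial.derivative_mul, hp, hX, Derivation.leibniz]
    simp only [smul_eq_mul, map_add, map_mul]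
    ring

theorem coeff_zero_lineExpansion {n : ℕ} (a : Fin n → ℂ) (p : MvPolynomial (Fin n) ℂ) :
    (lineExpansion a p).coeff 0 = p := by
  induction p using MvPolynomial.induction_on with
  | C c => simp [lineExpansion, MvPolynomial.algebraMap_eq, Polynomial.algebraMap_apply]
  | add p q hp hq => simp [hp, hq]
  | mul_X p i hp =>
    rw [map_mul, Polynomial.mul_coeff_zero, hp]
    simp [lineExpansion]

theorem factorial_mul_coeff_lineExpansion {n : ℕ} (a : Fin n → ℂ) (k : ℕ)
    (p : MvPolynomial (Fin n) ℂ) :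
    (k.factorial : MvPolynomial (Fin n) ℂ) * (lineExpansion a p).coeff k
      = (dirDeriv a)^[k] p := by
  induction k generalizing p with
  | zero => simp [coeff_zero_lineExpansion]
  | succ k ih =>
    rw [Function.iterate_succ_apply, ← ih, ← derivative_lineExpansion,
      Polynomial.coeff_derivative, Nat.factorial_succ]
    push_cast
    ring

theorem coeff_lineExpansion {n : ℕ} (a : Fin n → ℂ) (k : ℕ) (p : MvPolynomial (Fin n) ℂ) :
    (lineExpansion a p).coeff k = ((k.factorial : ℂ)⁻¹) • (dirDeriv a)^[k] p := by
  have hk : (k.factorial : ℂ) ≠ 0 := by exact_mod_cast k.factorial_ne_zero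
  rw [← factorial_mul_coeff_lineExpansion, ← nsmul_eq_mul, ← Nat.cast_smul_eq_nsmul ℂ,
    inv_smul_smul₀ hk]

theorem eval_lineExpansion {n : ℕ} (a : Fin n → ℂ) (c : ℂ) (p : MvPolynomial (Fin n) ℂ) :
    Polynomial.eval (MvPolynomial.C c) (lineExpansion a p)
      = shiftPoly (fun i => c * a i) p := by
  induction p using MvPolynomial.induction_on with
  | C c =>
    simp [lineExpansion, shiftPoly, MvPolynomial.algebraMap_eq, Polynomial.algebraMap_apply]
  | add p q hp hq => simp_all [shiftPoly]
  | mul_X p i hp =>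
    rw [map_mul, Polynomial.eval_mul, hp]
    simp [lineExpansion, shiftPoly, mul_comm (MvPolynomial.C c)]

/-- Taylor's formula along a line. -/
theorem shiftPoly_eq_sum {n : ℕ} (a : Fin n → ℂ) (c : ℂ) (p : MvPolynomial (Fin n) ℂ) {m : ℕ}
    (hm : (lineExpansion a p).natDegree < m) :
    shiftPoly (fun i => c * a i) p
      = ∑ k ∈ Finset.range m, (c ^ k * (k.factorial : ℂ)⁻¹) • (dirDeriv a)^[k] p := by
  rw [← eval_lineExpansion, Polynomial.eval_eq_sum_range' hm]
  refine Finset.sum_congr rfl fun k _ => ?_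
  rw [coeff_lineExpansion, ← MvPolynomial.C_pow, mul_comm, ← MvPolynomial.smul_eq_C_mul, smul_smul]

theorem homogeneousComponent_pderiv {n : ℕ} (i : Fin n) (d : ℕ) (p : MvPolynomial (Fin n) ℂ) :
    homogeneousComponent d (pderiv i p) = pderiv i (homogeneousComponent (d + 1) p) := by
  ext m
  simp only [coeff_homogeneousComponent, coeff_pderiv, map_add, Finsupp.degree_single,
    add_left_inj]
  split_ifs <;> simp

theorem homogeneousComponent_dirDeriv {n : ℕ} (a : Fin n → ℂ) (d : ℕ)
    (p : MvPolynomial (Fin n) ℂ) :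
    homogeneousComponent d (dirDeriv a p) = dirDeriv a (homogeneousComponent (d + 1) p) := by
  simp [dirDeriv, homogeneousComponent_C_mul, homogeneousComponent_pderiv]

theorem homogeneousComponent_iterate_dirDeriv {n : ℕ} (a : Fin n → ℂ) (k d : ℕ)
    (p : MvPolynomial (Fin n) ℂ) :
    homogeneousComponent d ((dirDeriv a)^[k] p)
      = (dirDeriv a)^[k] (homogeneousComponent (d + k) p) := by
  induction k generalizing p with
  | zero => simp
  | succ k ih =>
    rw [Function.iterate_succ_apply, ih, homogeneousComponent_dirDeriv,
      Function.iterate_succ_apply, add_assoc]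

theorem iterate_dirDeriv_zero {n : ℕ} (a : Fin n → ℂ) (k : ℕ) : (dirDeriv a)^[k] 0 = 0 := by
  rw [← coe_dirDerivation_pow, map_zero]

theorem iterate_dirDeriv_eq_zero {n : ℕ} (a : Fin n → ℂ) {k : ℕ} {p : MvPolynomial (Fin n) ℂ}
    (hk : p.totalDegree < k) : (dirDeriv a)^[k] p = 0 := by
  rw [← sum_homogeneousComponent ((dirDeriv a)^[k] p)]
  refine Finset.sum_eq_zero fun d _ => ?_
  rw [homogeneousComponent_iterate_dirDeriv, homogeneousComponent_eq_zero _ _ (by omega),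
    iterate_dirDeriv_zero]

theorem isHomogeneous_linPoly {n : ℕ} (a : Fin n → ℂ) : (linPoly a).IsHomogeneous 1 :=
  IsHomogeneous.sum _ _ _ fun i _ => (isHomogeneous_X ℂ i).C_mul (a i)

theorem dvd_homogeneousComponent_of_isHomogeneous {n e : ℕ} {f g : MvPolynomial (Fin n) ℂ}
    (hf : f.IsHomogeneous e) (h : f ∣ g) (d : ℕ) : f ∣ homogeneousComponent d g := by
  let : GradedAlgebra (homogeneousSubmodule (Fin n) ℂ) := MvPolynomial.gradedAlgebra
  have hI : (Ideal.span {f}).IsHomogeneous (homogeneousSubmodule (Fin n) ℂ) :=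
    Ideal.homogeneous_span _ _ (by rintro _ rfl; exact ⟨e, hf⟩)
  rw [← Ideal.mem_span_singleton] at h ⊢
  exact (mem_iff_homogeneousComponent_mem hI g).1 h d

/-- Inverting a Vandermonde system modulo a submodule. -/
theorem mem_of_forall_vandermonde_sum_mem {K V : Type*} [Field K] [AddCommGroup V] [Module K V]
    (W : Submodule K V) {s : ℕ} {x : Fin s → K} (hx : Function.Injective x) (v : Fin s → V)
    (h : ∀ j, ∑ k : Fin s, x j ^ (k : ℕ) • v k ∈ W) (i : Fin s) : v i ∈ W := by
  have hdet : IsUnit (Matrix.vandermonde x).det :=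
    (Matrix.det_vandermonde_ne_zero_iff.2 hx).isUnit
  have hv : v i = ∑ j, (Matrix.vandermonde x)⁻¹ i j • ∑ k : Fin s, x j ^ (k : ℕ) • v k := by
    simp_rw [Finset.smul_sum, smul_smul]
    rw [Finset.sum_comm]
    simp_rw [← Finset.sum_smul]
    have hone (k : Fin s) : ∑ j, (Matrix.vandermonde x)⁻¹ i j * x j ^ (k : ℕ)
        = (1 : Matrix (Fin s) (Fin s) K) i k := by
      rw [← Matrix.nonsing_inv_mul _ hdet, Matrix.mul_apply]
      rfl
    simp [hone, Matrix.one_apply]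
  rw [hv]
  exact W.sum_mem fun j _ => W.smul_mem _ (h j)

theorem sum_range_two_mul {M : Type*} [AddCommMonoid M] (f : ℕ → M) (s : ℕ) :
    ∑ k ∈ Finset.range (2 * s), f k
      = ∑ j ∈ Finset.range s, (f (2 * j) + f (2 * j + 1)) := by
  induction s with
  | zero => simp
  | succ s ih =>
    rw [Finset.sum_range_succ, ← ih, Nat.mul_succ, Finset.sum_range_succ, Finset.sum_range_succ,
      add_assoc]

/-- The component of degree `d` of `p(x + ca) - p(x - ca)`, when `d + (2s - 1)` is the degree
of `p`. -/
theorem homogeneousComponent_shiftPoly_sub {n : ℕ} (a : Fin n → ℂ) (c : ℂ)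
    (p : MvPolynomial (Fin n) ℂ) {d s : ℕ} (hd : p.totalDegree + 1 = d + 2 * s) :
    homogeneousComponent d (shiftPoly (fun i => c * a i) p - shiftPoly (fun i => -(c * a i)) p)
      = c • ∑ j : Fin s, (c ^ 2) ^ (j : ℕ) • ((2 * ((2 * j + 1 : ℕ).factorial : ℂ)⁻¹) •
          (dirDeriv a)^[2 * j + 1] (homogeneousComponent (d + (2 * j + 1)) p)) := by
  set m := 2 * s + ((lineExpansion a p).natDegree + 1) with hm
  have hneg : (fun i => -(c * a i)) = fun i => -c * a i := by
    funext i
    ring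
  rw [hneg, shiftPoly_eq_sum a c p (m := m) (by omega),
    shiftPoly_eq_sum a (-c) p (m := m) (by omega), ← Finset.sum_sub_distrib, map_sum]
  simp_rw [← sub_smul, map_smul, homogeneousComponent_iterate_dirDeriv]
  rw [← Finset.sum_subset (s₁ := Finset.range (2 * s))
    (Finset.range_subset_range.2 (by omega)), sum_range_two_mul, Finset.smul_sum,
    ← Fin.sum_univ_eq_sum_range]
  · refine Finset.sum_congr rfl fun j _ => ?_
    have heven : (-c) ^ (2 * (j : ℕ)) = c ^ (2 * (j : ℕ)) := by simp [pow_mul]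
    have hodd : (-c) ^ (2 * (j : ℕ) + 1) = -c ^ (2 * (j : ℕ) + 1) := by
      rw [pow_succ, heven, pow_succ]
      ring
    rw [heven, sub_self, zero_smul, zero_add, hodd, smul_smul, smul_smul]
    congr 1
    ring
  · intro k _ hk
    rw [Finset.mem_range, not_lt] at hk
    rw [homogeneousComponent_eq_zero _ _ (by omega), iterate_dirDeriv_zero, smul_zero]

/-- If `(a,x)` divides `p(x + ca) - p(x - ca)` for `s` values of `c` with nonzero distinct
squares, then it divides `∂_a^{2s-1} p₀`. -/
theorem linPoly_dvd_iterate_dirDeriv {n : ℕ} (a : Fin n → ℂ) (p : MvPolynomial (Fin n) ℂ)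
    {s : ℕ} (hs : 1 ≤ s) (c : Fin s → ℂ) (hc : ∀ j, c j ≠ 0)
    (hinj : Function.Injective fun j => c j ^ 2)
    (h : ∀ j, linPoly a ∣
      shiftPoly (fun i => c j * a i) p - shiftPoly (fun i => -(c j * a i)) p) :
    linPoly a ∣ (dirDeriv a)^[2 * s - 1] (homogeneousComponent p.totalDegree p) := by
  rcases le_or_gt (2 * s - 1) p.totalDegree with hle | hlt
  · obtain ⟨d, hd⟩ := Nat.exists_eq_add_of_le hle
    let W : Submodule ℂ (MvPolynomial (Fin n) ℂ) :=
      (Ideal.span {linPoly a}).restrictScalars ℂ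
    have hW (f : MvPolynomial (Fin n) ℂ) : f ∈ W ↔ linPoly a ∣ f :=
      Ideal.mem_span_singleton
    have key := mem_of_forall_vandermonde_sum_mem W hinj
      (fun k : Fin s => (2 * ((2 * k + 1 : ℕ).factorial : ℂ)⁻¹) •
          (dirDeriv a)^[2 * k + 1] (homogeneousComponent (d + (2 * k + 1)) p))
      (fun j => by
        have hj := dvd_homogeneousComponent_of_isHomogeneous (isHomogeneous_linPoly a) (h j) d
        rw [homogeneousComponent_shiftPoly_sub a (c j) p (s := s) (by omega), ← hW] at hj
        exact (W.smul_mem_iff (hc j)).1 hj) ⟨s - 1, by omega⟩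
    rw [W.smul_mem_iff (by simp [Nat.factorial_ne_zero]), hW] at key
    have hk : 2 * (s - 1) + 1 = 2 * s - 1 := by omega
    rw [hd, add_comm]
    simpa only [hk] using key
  · rw [iterate_dirDeriv_eq_zero a
      (((homogeneousComponent_isHomogeneous _ _).totalDegree_le).trans_lt hlt)]
    exact dvd_zero _

/-- if `(α,x)` divides `p(x+sα) − p(x−sα)` for `s = 1,…,l` and
`(α,x)` divides `p(x+(l+2s)α) − p(x−(l+2s)α)` for `s = 1,…,r`, then the highest-degree
homogeneous part `p_0` of `p` satisfies `(α,x) ∣ ∂_α^{2s−1} p_0` for `s = 1,…,l+r`. -/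
theorem stmt_14 (N : ℕ) (hN : 0 < N)
    (a : Fin N → ℝ) (ha : a ≠ 0)
    (l r : ℕ)
    (p : MvPolynomial (Fin N) ℂ) (hp : p ≠ 0)
    (h1 : ∀ s : ℕ, 1 ≤ s → s ≤ l →
      linPoly (fun i => ((a i : ℝ) : ℂ)) ∣
        shiftPoly (fun i => (s : ℂ) * (a i : ℂ)) p
          - shiftPoly (fun i => -((s : ℂ) * (a i : ℂ))) p)
    (h2 : ∀ s : ℕ, 1 ≤ s → s ≤ r →
      linPoly (fun i => ((a i : ℝ) : ℂ)) ∣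
        shiftPoly (fun i => ((l + 2 * s : ℕ) : ℂ) * (a i : ℂ)) p
          - shiftPoly (fun i => -(((l + 2 * s : ℕ) : ℂ) * (a i : ℂ))) p) :
    ∀ s : ℕ, 1 ≤ s → s ≤ l + r →
      linPoly (fun i => ((a i : ℝ) : ℂ)) ∣
        (dirDeriv (fun i => ((a i : ℝ) : ℂ)))^[2 * s - 1]
          (MvPolynomial.homogeneousComponent p.totalDegree p) := by
  intro s hs hsl
  let c : Fin s → ℕ := fun j => if (j : ℕ) < l then j + 1 else l + 2 * (j + 1 - l)
  have hcpos (j : Fin s) : 0 < c j := by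
    simp only [c]
    split_ifs <;> omega
  have hcinj : Function.Injective c := by
    intro i j hij
    simp only [c] at hij
    ext
    split_ifs at hij <;> omega
  refine linPoly_dvd_iterate_dirDeriv _ p hs (fun j => (c j : ℂ))
    (fun j => by exact_mod_cast (hcpos j).ne') (fun i j hij => hcinj ?_) fun j => ?_
  · have hij' : c i ^ 2 = c j ^ 2 := by
      dsimp only at hij
      exact_mod_cast hij
    exact Nat.pow_left_injective two_ne_zero hij'
  · by_cases hj : (j : ℕ) < l
    · simpa only [c, if_pos hj] using h1 (j + 1) (by omega) (by omega)
    · simpa only [c, if_neg hj] using h2 (j + 1 - l) (by omega) (by omega)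

end
end

section
/- If p ∈ Q_m^{tr}(BC_N), then its highest-degree homogeneous part p_0 belongs to Q_{m̃}: that is, x_j^{2(m_1+m_2)} divides p_0 − σ_j·p_0 for all j, (x_i − x_j)^{2m_3} divides p_0 − τ_{ij}·p_0, and (x_i + x_j)^{2m_3} divides p_0 − ρ_{ij}·p_0, for all i ≠ j. -/
open MvPolynomial

noncomputable section

/-- `σ_j`: negation of the `j`-th coordinate. -/
def sigmaP {n : ℕ} (j : Fin n) (p : MvPolynomial (Fin n) ℂ) : MvPolynomial (Fin n) ℂ :=
  MvPolynomial.aeval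
    (fun k => if k = j then -(MvPolynomial.X j) else (MvPolynomial.X k : MvPolynomial (Fin n) ℂ)) p

/-- `τ_{ij}`: transposition of the `i`-th and `j`-th coordinates. -/
def swapP {n : ℕ} (i j : Fin n) (p : MvPolynomial (Fin n) ℂ) : MvPolynomial (Fin n) ℂ :=
  MvPolynomial.aeval
    (fun k => if k = i then MvPolynomial.X j
      else if k = j then MvPolynomial.X i else (MvPolynomial.X k : MvPolynomial (Fin n) ℂ)) p

/-- `ρ_{ij}`: swap of the `i`-th and `j`-th coordinates combined with negating both. -/
def rhoP {n : ℕ} (i j : Fin n) (p : MvPolynomial (Fin n) ℂ) : MvPolynomial (Fin n) ℂ :=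
  MvPolynomial.aeval
    (fun k => if k = i then -(MvPolynomial.X j)
      else if k = j then -(MvPolynomial.X i) else (MvPolynomial.X k : MvPolynomial (Fin n) ℂ)) p

/-- The trigonometric quasi-invariants of type `BC_N`. -/
def QtrBC (N : ℕ) (m1 m2 m3 : ℕ) : Set (MvPolynomial (Fin N) ℂ) :=
  {p | (∀ j : Fin N, ∀ s : ℕ, 1 ≤ s → s ≤ m1 →
          MvPolynomial.X j ∣
            shiftPoly (Pi.single j ((s : ℂ))) p - shiftPoly (Pi.single j (-(s : ℂ))) p) ∧
       (∀ j : Fin N, ∀ s : ℕ, 1 ≤ s → s ≤ m2 →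
          MvPolynomial.X j ∣
            shiftPoly (Pi.single j ((s : ℂ) - 1/2)) p
              - shiftPoly (Pi.single j (-((s : ℂ) - 1/2))) p) ∧
       (∀ i j : Fin N, i ≠ j → ∀ s : ℕ, 1 ≤ s → s ≤ m3 →
          ((MvPolynomial.X i - MvPolynomial.X j) ∣
            shiftPoly (Pi.single i ((s : ℂ))) p - shiftPoly (Pi.single j ((s : ℂ))) p) ∧
          ((MvPolynomial.X i + MvPolynomial.X j) ∣
            shiftPoly (Pi.single i (-(s : ℂ))) p - shiftPoly (Pi.single j ((s : ℂ))) p))}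

/-- The `B_N` quasi-invariants `Q_{m̃}` with multiplicity `m̃(e_i) = m_1 + m_2`,
`m̃(e_i ± e_j) = m_3`. -/
def QtildeBC (N : ℕ) (m1 m2 m3 : ℕ) : Set (MvPolynomial (Fin N) ℂ) :=
  {q | (∀ j : Fin N, MvPolynomial.X j ^ (2 * (m1 + m2)) ∣ q - sigmaP j q) ∧
       (∀ i j : Fin N, i ≠ j →
          ((MvPolynomial.X i - MvPolynomial.X j) ^ (2 * m3) ∣ q - swapP i j q) ∧
          ((MvPolynomial.X i + MvPolynomial.X j) ^ (2 * m3) ∣ q - rhoP i j q))}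

section TopComponent

variable {σ K : Type*} [Field K]

lemma homogeneousComponent_mul_of_isHomogeneous_left {m : ℕ} {L : MvPolynomial σ K}
    (hL : L.IsHomogeneous m) (n : ℕ) (h : MvPolynomial σ K) :
    homogeneousComponent (m + n) (L * h) = L * homogeneousComponent n h := by
  conv_lhs => rw [← sum_homogeneousComponent h]
  rw [Finset.mul_sum, map_sum]
  have key (i : ℕ) : homogeneousComponent (m + n) (L * homogeneousComponent i h) =
      if i = n then L * homogeneousComponent n h else 0 := by
    rw [homogeneousComponent_of_mem (hL.mul (homogeneousComponent_isHomogeneous i h))]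
    by_cases hi : i = n
    · simp [hi]
    · rw [if_neg (by omega), if_neg hi]
  simp only [key, Finset.sum_ite_eq', Finset.mem_range]
  split_ifs with hn
  · rfl
  · rw [homogeneousComponent_eq_zero _ _ (by omega), mul_zero]

lemma homogeneousComponent_aeval_of_isHomogeneous_one {τ : Type*} {f : σ → MvPolynomial τ K}
    (hf : ∀ k, (f k).IsHomogeneous 1) (n : ℕ) (p : MvPolynomial σ K) :
    homogeneousComponent n (aeval f p) = aeval f (homogeneousComponent n p) := by
  conv_lhs => rw [← sum_homogeneousComponent p]
  rw [map_sum, map_sum]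
  have key (i : ℕ) : homogeneousComponent n (aeval f (homogeneousComponent i p)) =
      if i = n then aeval f (homogeneousComponent n p) else 0 := by
    have := (homogeneousComponent_isHomogeneous i p).aeval f hf
    rw [one_mul] at this
    rw [homogeneousComponent_of_mem this]
    by_cases hi : i = n
    · simp [hi]
    · rw [if_neg (by omega), if_neg hi]
  simp only [key, Finset.sum_ite_eq', Finset.mem_range]
  split_ifs with hn
  · rfl
  · rw [homogeneousComponent_eq_zero _ _ (by omega), map_zero]

lemma one_le_totalDegree_sub_C {L : MvPolynomial σ K} (hL : L.IsHomogeneous 1) (hL0 : L ≠ 0)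
    (a : K) : 1 ≤ (L - C a).totalDegree := by
  by_contra! h
  apply hL0
  have h1 := homogeneousComponent_eq_zero _ _ h
  rwa [map_sub, homogeneousComponent_eq_self hL, homogeneousComponent_of_mem
    (isHomogeneous_C _ a), if_neg (by omega), sub_zero] at h1

/-- If `g` is divisible by a product of translates of a linear form `L`, then the top-degree
part of `g` is divisible by the corresponding power of `L`. -/
lemma pow_card_dvd_homogeneousComponent_of_prod_dvd {ι : Type*} {L : MvPolynomial σ K}
    (hL : L.IsHomogeneous 1) (hL0 : L ≠ 0) (a : ι → K) (s : Finset ι) {g : MvPolynomial σ K}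
    {d : ℕ} (hd : g.totalDegree ≤ d) (hg : ∏ i ∈ s, (L - C (a i)) ∣ g) :
    L ^ s.card ∣ homogeneousComponent d g := by
  classical
  induction s using Finset.induction_on generalizing g d with
  | empty => simp
  | insert i s hi ih =>
    rw [Finset.prod_insert hi, mul_comm] at hg
    obtain ⟨c, rfl⟩ := hg
    rw [mul_right_comm, mul_comm] at hd ⊢
    set h := (∏ i ∈ s, (L - C (a i))) * c with hh
    by_cases h0 : h = 0
    · simp [h0]
    have hdeg := one_le_totalDegree_sub_C hL hL0 (a i)
    have hne : L - C (a i) ≠ 0 := by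
      intro h
      simp [h] at hdeg
    rw [totalDegree_mul_of_isDomain hne h0] at hd
    obtain ⟨e, rfl⟩ : ∃ e, d = 1 + e := ⟨d - 1, by omega⟩
    rw [sub_mul, map_sub, homogeneousComponent_mul_of_isHomogeneous_left hL,
      homogeneousComponent_C_mul, homogeneousComponent_eq_zero (1 + e) h (by omega), mul_zero,
      sub_zero, Finset.card_insert_of_notMem hi, pow_succ']
    exact mul_dvd_mul_left _ (ih (by omega) (Dvd.intro _ rfl))

lemma isCoprime_sub_C {L : MvPolynomial σ K} {a b : K} (hab : a ≠ b) :
    IsCoprime (L - C a) (L - C b) := by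
  refine ⟨C (b - a)⁻¹, -C (b - a)⁻¹, ?_⟩
  have : C (b - a)⁻¹ * (C b - C a) = (1 : MvPolynomial σ K) := by
    rw [← C_sub, ← C_mul, inv_mul_cancel₀ (sub_ne_zero.2 hab.symm), C_1]
  linear_combination this

/-- If `p - φ p` is divisible by distinct translates of a linear form `L`, where `φ` is a linear
substitution, then `p₀ - φ p₀` is divisible by a power of `L`, for `p₀` the top part of `p`. -/
lemma pow_card_dvd_homogeneousComponent_sub_aeval {ι : Type*} [Fintype ι] {L : MvPolynomial σ K}
    (hL : L.IsHomogeneous 1) (hL0 : L ≠ 0) {a : ι → K} (ha : Function.Injective a)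
    {f : σ → MvPolynomial σ K} (hf : ∀ k, (f k).IsHomogeneous 1) (p : MvPolynomial σ K)
    (hdvd : ∀ i, L - C (a i) ∣ p - aeval f p) :
    L ^ Fintype.card ι ∣ homogeneousComponent p.totalDegree p -
      aeval f (homogeneousComponent p.totalDegree p) := by
  have hprod : ∏ i, (L - C (a i)) ∣ p - aeval f p :=
    Fintype.prod_dvd_of_coprime (fun _ _ hij => isCoprime_sub_C (ha.ne hij)) hdvd
  rw [← homogeneousComponent_aeval_of_isHomogeneous_one hf, ← map_sub]
  refine pow_card_dvd_homogeneousComponent_of_prod_dvd hL hL0 a Finset.univ ?_ hprod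
  refine (totalDegree_sub _ _).trans (max_le le_rfl ?_)
  refine Finset.sup_le fun b hb => ?_
  by_contra! hlt
  have h0 := homogeneousComponent_aeval_of_isHomogeneous_one hf (b.sum fun _ e => e) p
  rw [homogeneousComponent_eq_zero _ _ hlt, map_zero] at h0
  have h1 := congrArg (coeff b) h0
  rw [coeff_homogeneousComponent, if_pos (by simp [Finsupp.degree_apply, Finsupp.sum]),
    coeff_zero] at h1
  exact (mem_support_iff.1 hb) h1

lemma dvd_aeval_sub_aeval {A : Type*} [CommRing A] [Algebra K A] {D : A} {f g : σ → A}
    (h : ∀ k, D ∣ f k - g k) (p : MvPolynomial σ K) : D ∣ aeval f p - aeval g p := by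
  simp only [← Ideal.mem_span_singleton, ← Ideal.Quotient.eq] at h ⊢
  have := congrArg (fun u => aeval u p) (funext h)
  have comp (u : σ → A) : Ideal.Quotient.mk (Ideal.span {D}) (aeval u p) =
      aeval (fun k => Ideal.Quotient.mk (Ideal.span {D}) (u k)) p := by
    rw [← Ideal.Quotient.mkₐ_eq_mk K, comp_aeval_apply]
  rw [comp, comp, this]

end TopComponent

lemma dvd_sub_aeval_of_dvd_shiftPoly_sub {n : ℕ} {v w : Fin n → ℂ}
    {D₀ D p : MvPolynomial (Fin n) ℂ} {f : Fin n → MvPolynomial (Fin n) ℂ}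
    (hp : D₀ ∣ shiftPoly v p - shiftPoly w p) (hD : shiftPoly (-v) D₀ = D)
    (h : ∀ k, D ∣ X k + C (w k - v k) - f k) : D ∣ p - aeval f p := by
  have h1 : shiftPoly (-v) D₀ ∣ shiftPoly (-v) (shiftPoly v p - shiftPoly w p) :=
    map_dvd (aeval fun i => X i + C ((-v) i)) hp
  have comp (u : Fin n → ℂ) : shiftPoly (-v) (shiftPoly u p) =
      aeval (fun k => X k + C (u k - v k)) p := by
    simp only [shiftPoly]
    rw [← AlgHom.comp_apply, comp_aeval]
    congr 2
    ext1 k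
    simp
    ring
  have hsub : shiftPoly (-v) (shiftPoly v p - shiftPoly w p) =
      p - aeval (fun k => X k + C (w k - v k)) p := by
    rw [← comp w]
    have : shiftPoly (-v) (shiftPoly v p) = p := by simp [comp v]
    conv_rhs => enter [1]; rw [← this]
    simp [shiftPoly]
  rw [hD, hsub] at h1
  have := dvd_add h1 (dvd_aeval_sub_aeval h p)
  rwa [sub_add_sub_cancel] at this

/-- The nonzero integers `±1, …, ±m`, indexed by `Fin m × Bool`. -/
def signedSucc {m : ℕ} (x : Fin m × Bool) : ℤ :=
  if x.2 then (x.1 : ℤ) + 1 else -((x.1 : ℤ) + 1)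

lemma signedSucc_injective {m : ℕ} : Function.Injective (signedSucc (m := m)) := by
  rintro ⟨⟨k, hk⟩, b⟩ ⟨⟨l, hl⟩, c⟩ h
  cases b <;> cases c <;> simp [signedSucc] at h ⊢ <;> omega

/-- Twice the shifts `±1, …, ±m₁` and `±1/2, …, ±(m₂ - 1/2)`. -/
def doubledShift {m₁ m₂ : ℕ} (x : (Fin m₁ ⊕ Fin m₂) × Bool) : ℤ :=
  (if x.2 then 1 else -1) * 
    Sum.elim (fun k : Fin m₁ => 2 * (k : ℤ) + 2) (fun k : Fin m₂ => 2 * (k : ℤ) + 1) x.1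

lemma doubledShift_injective {m₁ m₂ : ℕ} :
    Function.Injective (doubledShift (m₁ := m₁) (m₂ := m₂)) := by
  rintro ⟨⟨k, hk⟩ | ⟨k, hk⟩, b⟩ ⟨⟨l, hl⟩ | ⟨l, hl⟩, c⟩ h <;>
  cases b <;> cases c <;> simp [doubledShift] at h ⊢ <;> omega

lemma dvd_sub_sigmaP {n : ℕ} {j : Fin n} {s : ℂ} {p : MvPolynomial (Fin n) ℂ}
    (hp : X j ∣ shiftPoly (Pi.single j s) p - shiftPoly (Pi.single j (-s)) p) :
    X j - C s ∣ p - sigmaP j p := by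
  refine dvd_sub_aeval_of_dvd_shiftPoly_sub hp (by simp [shiftPoly, sub_eq_add_neg]) fun k => ?_
  by_cases hk : k = j
  · subst hk
    refine ⟨2, ?_⟩
    simp
    ring
  · simp [hk]

lemma dvd_sub_swapP {n : ℕ} {i j : Fin n} (hij : i ≠ j) {s : ℂ} {p : MvPolynomial (Fin n) ℂ}
    (hp : X i - X j ∣ shiftPoly (Pi.single i s) p - shiftPoly (Pi.single j s) p) :
    X i - X j - C s ∣ p - swapP i j p := by
  refine dvd_sub_aeval_of_dvd_shiftPoly_sub hp
    (by simp [shiftPoly, hij.symm]; ring) fun k => ?_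
  by_cases hk : k = i
  · subst hk
    refine ⟨1, ?_⟩
    simp [hij]
    ring
  by_cases hk' : k = j
  · subst hk'
    refine ⟨-1, ?_⟩
    simp [hk]
    ring
  · simp [hk, hk']

lemma swapP_comm {n : ℕ} (i j : Fin n) (p : MvPolynomial (Fin n) ℂ) :
    swapP i j p = swapP j i p := by
  unfold swapP
  congr 2
  ext1 k
  split_ifs <;> simp_all

lemma dvd_sub_rhoP {n : ℕ} {i j : Fin n} (hij : i ≠ j) {s : ℂ} {p : MvPolynomial (Fin n) ℂ}
    (hp : X i + X j ∣ shiftPoly (Pi.single i s) p - shiftPoly (Pi.single j (-s)) p) :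
    X i + X j - C s ∣ p - rhoP i j p := by
  refine dvd_sub_aeval_of_dvd_shiftPoly_sub hp
    (by simp [shiftPoly, hij.symm]; ring) fun k => ?_
  by_cases hk : k = i
  · subst hk
    refine ⟨1, ?_⟩
    simp [hij]
    ring
  by_cases hk' : k = j
  · subst hk'
    refine ⟨1, ?_⟩
    simp [hk]
    ring
  · simp [hk, hk']

/-- if `p ∈ Q_m^{tr}(BC_N)` then its highest-degree homogeneous part `p_0`
belongs to `Q_{m̃}`. -/
theorem stmt_15 (N : ℕ) (hN : 2 ≤ N) (m1 m2 m3 : ℕ)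
    (p : MvPolynomial (Fin N) ℂ) (hp0 : p ≠ 0)
    (hp : p ∈ QtrBC N m1 m2 m3) :
    MvPolynomial.homogeneousComponent p.totalDegree p ∈ QtildeBC N m1 m2 m3 := by
  obtain ⟨h1, h2, h3⟩ := hp
  have hX (k : Fin N) : (X k : MvPolynomial (Fin N) ℂ).IsHomogeneous 1 := isHomogeneous_X _ k
  refine ⟨fun j => ?_, fun i j hij => ⟨?_, ?_⟩⟩
  · have key := pow_card_dvd_homogeneousComponent_sub_aeval (hX j) (X_ne_zero j)
      (a := fun x => ((doubledShift (m₁ := m1) (m₂ := m2) x : ℤ) : ℂ) / 2)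
      (fun x y h => doubledShift_injective (by simpa using h))
      (f := fun k => if k = j then -X j else X k)
      (fun k => by split_ifs; exacts [(hX j).neg, hX k]) p ?_
    · simpa only [Fintype.card_prod, Fintype.card_sum, Fintype.card_fin, Fintype.card_bool,
        mul_comm, sigmaP] using key
    · rintro ⟨k | k, b⟩
      · have h := h1 j (k + 1) (by omega) (by omega)
        cases b
        · refine dvd_sub_sigmaP ?_
          rw [dvd_sub_comm]
          convert h using 4 <;> simp [doubledShift] <;> ring
        · refine dvd_sub_sigmaP ?_
          convert h using 4 <;> simp [doubledShift] <;> ring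
      · have h := h2 j (k + 1) (by omega) (by omega)
        cases b
        · refine dvd_sub_sigmaP ?_
          rw [dvd_sub_comm]
          convert h using 4 <;> simp [doubledShift] <;> ring
        · refine dvd_sub_sigmaP ?_
          convert h using 4 <;> simp [doubledShift] <;> ring
  · have hne : (X i - X j : MvPolynomial (Fin N) ℂ) ≠ 0 := fun h => by
      simpa [hij.symm] using congrArg (eval (Pi.single i 1)) h
    have key := pow_card_dvd_homogeneousComponent_sub_aeval ((hX i).sub (hX j)) hne
      (a := fun x => ((signedSucc (m := m3) x : ℤ) : ℂ))
      (Int.cast_injective.comp signedSucc_injective)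
      (f := fun k => if k = i then X j else if k = j then X i else X k)
      (fun k => by split_ifs; exacts [hX j, hX i, hX k]) p ?_
    · simpa only [Fintype.card_prod, Fintype.card_sum, Fintype.card_fin, Fintype.card_bool,
        mul_comm, swapP] using key
    · rintro ⟨k, b⟩
      cases b
      · have h := dvd_sub_swapP hij.symm (h3 j i hij.symm (k + 1) (by omega) (by omega)).1
        rw [swapP_comm, ← neg_dvd] at h
        change _ ∣ p - swapP i j p
        convert h using 1
        simp [signedSucc]
        ring
      · refine dvd_sub_swapP hij ?_
        simpa [signedSucc] using (h3 i j hij (k + 1) (by omega) (by omega)).1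
  · have hne : (X i + X j : MvPolynomial (Fin N) ℂ) ≠ 0 := fun h => by
      simpa [hij.symm] using congrArg (eval (Pi.single i 1)) h
    have key := pow_card_dvd_homogeneousComponent_sub_aeval ((hX i).add (hX j)) hne
      (a := fun x => ((signedSucc (m := m3) x : ℤ) : ℂ))
      (Int.cast_injective.comp signedSucc_injective)
      (f := fun k => if k = i then -X j else if k = j then -X i else X k)
      (fun k => by split_ifs; exacts [(hX j).neg, (hX i).neg, hX k]) p ?_
    · simpa only [Fintype.card_prod, Fintype.card_sum, Fintype.card_fin, Fintype.card_bool,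
        mul_comm, rhoP] using key
    · rintro ⟨k, b⟩
      refine dvd_sub_rhoP hij ?_
      cases b
      · simpa [signedSucc] using (h3 i j hij (k + 1) (by omega) (by omega)).2
      · have h := (h3 j i hij.symm (k + 1) (by omega) (by omega)).2
        rw [dvd_sub_comm, add_comm]
        simpa [signedSucc] using h

end
end
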